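/- Let G = G_l ⊕ G_r be an attachment composition, assume D_k(H) ≠ ∅ for each H ∈ {G, G_l, G_r} and each 0 ≤ k ≤ |TS(H)|, and assume Equation (2) holds for G_l and for G_r. Suppose α(G_r) ≤ β(G_l), and suppose that neither (α(G_l) = 0 and β(G_r) = 0) nor (α(G_r) = 0 and β(G_l) = 0). Then min(G) = min(G_l) + min(G_r), β(G) = β(G_l) − α(G_r), and α(G) = α(G_l) − β(G_r) if α(G_l) > β(G_r), while α(G) = |α(G_l) − α(G_r)| mod 2 otherwise. -/

import Mathlib

/-- A finite simple graph on a subset of an ambient vertex type `α`,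
together with a designated twin set `TS ⊆ verts`. -/
structure TSGraph (α : Type*) where
  verts : Finset α
  Adj : α → α → Prop
  symm : ∀ u v, Adj u v → Adj v u
  irrefl : ∀ u, ¬ Adj u u
  adj_mem : ∀ u v, Adj u v → u ∈ verts ∧ v ∈ verts
  TS : Finset α
  TS_sub : TS ⊆ verts

namespace TSGraph

variable {α : Type*} [DecidableEq α]

/-- `f` encodes a perfect matching of the subgraph of `G` induced by `S`:
every vertex of `S` is paired with an adjacent vertex of `S`, involutively. -/
def IsPM (G : TSGraph α) (S : Finset α) (f : α → α) : Prop :=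
  ∀ v ∈ S, f v ∈ S ∧ G.Adj v (f v) ∧ f (f v) = v

/-- `S ⊆ V(G)` dominates `V(G) − TS(G)` and, for some `X ⊆ S ∩ TS(G)` of size `k`,
the subgraph induced by `S − X` has a perfect matching. -/
def Adm (G : TSGraph α) (k : ℕ) (S : Finset α) : Prop :=
  S ⊆ G.verts ∧
  (∀ v ∈ G.verts, v ∉ G.TS → v ∈ S ∨ ∃ u ∈ S, G.Adj u v) ∧
  ∃ X ⊆ S ∩ G.TS, X.card = k ∧ ∃ f, G.IsPM (S \ X) f

/-- Membership in the family `D_k(G)`: admissible of minimum cardinality. -/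
def memD (G : TSGraph α) (k : ℕ) (S : Finset α) : Prop :=
  G.Adm k S ∧ ∀ S', G.Adm k S' → S.card ≤ S'.card

/-- `D_k(G) ≠ ∅`. -/
def DkNonempty (G : TSGraph α) (k : ℕ) : Prop := ∃ S, G.memD k S

/-- `D_k(G) ≠ ∅` for all `0 ≤ k ≤ |TS(G)|`. -/
def AllDkNonempty (G : TSGraph α) : Prop := ∀ k ≤ G.TS.card, G.DkNonempty k

/-- `γ_k(G)`: the common cardinality of the members of `D_k(G)`. -/
noncomputable def gamma (G : TSGraph α) (k : ℕ) : ℕ :=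
  sInf {n | ∃ S, G.Adm k S ∧ S.card = n}

/-- A paired-dominating set of `G`. -/
def IsPDS (G : TSGraph α) (D : Finset α) : Prop :=
  D ⊆ G.verts ∧
  (∀ v ∈ G.verts, v ∈ D ∨ ∃ u ∈ D, G.Adj u v) ∧
  ∃ f, G.IsPM D f

/-- `γ_p(G)`: the paired-domination number. -/
noncomputable def gammaP (G : TSGraph α) : ℕ :=
  sInf {n | ∃ D, G.IsPDS D ∧ D.card = n}

/-- Membership in `D_p(G)`: minimum-cardinality paired-dominating sets. -/
def memDp (G : TSGraph α) (D : Finset α) : Prop :=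
  G.IsPDS D ∧ D.card = G.gammaP

/-- `min(G) = min { γ_k(G) : 0 ≤ k ≤ |TS(G)| }`. -/
noncomputable def minVal (G : TSGraph α) : ℕ :=
  sInf {n | ∃ k ≤ G.TS.card, G.gamma k = n}

/-- `α(G)`: the smallest `k` with `γ_k(G) = min(G)`. -/
noncomputable def alphaVal (G : TSGraph α) : ℕ :=
  sInf {k | k ≤ G.TS.card ∧ G.gamma k = G.minVal}

/-- `β(G)`: the largest `k` with `γ_k(G) = min(G)`. -/
noncomputable def betaVal (G : TSGraph α) : ℕ :=
  sSup {k | k ≤ G.TS.card ∧ G.gamma k = G.minVal}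

/-- Membership in `Ψ(G)`: sets in some `D_k(G)` of cardinality `min(G)`. -/
def memPsi (G : TSGraph α) (D : Finset α) : Prop :=
  (∃ k, k ≤ G.TS.card ∧ G.memD k D) ∧ D.card = G.minVal

/-- Equation (2) holds for `G`. -/
def Eq2Holds (G : TSGraph α) : Prop :=
  ∀ k ≤ G.TS.card,
    (k ≤ G.alphaVal → G.gamma k = G.minVal + G.alphaVal - k) ∧
    (G.betaVal ≤ k → G.gamma k = G.minVal + k - G.betaVal) ∧
    (G.alphaVal < k → k < G.betaVal → Even (k - G.alphaVal) → G.gamma k = G.minVal) ∧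
    (G.alphaVal < k → k < G.betaVal → ¬ Even (k - G.alphaVal) → G.gamma k = G.minVal + 1)

/-- `G = Gl ⊗ Gr` (true twin composition). -/
def IsTrueTwin (G Gl Gr : TSGraph α) : Prop :=
  Disjoint Gl.verts Gr.verts ∧
  G.verts = Gl.verts ∪ Gr.verts ∧
  (∀ u v, G.Adj u v ↔ Gl.Adj u v ∨ Gr.Adj u v ∨
    (u ∈ Gl.TS ∧ v ∈ Gr.TS) ∨ (u ∈ Gr.TS ∧ v ∈ Gl.TS)) ∧
  G.TS = Gl.TS ∪ Gr.TS

/-- `G = Gl ⊙ Gr` (false twin composition). -/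
def IsFalseTwin (G Gl Gr : TSGraph α) : Prop :=
  Disjoint Gl.verts Gr.verts ∧
  G.verts = Gl.verts ∪ Gr.verts ∧
  (∀ u v, G.Adj u v ↔ Gl.Adj u v ∨ Gr.Adj u v) ∧
  G.TS = Gl.TS ∪ Gr.TS

/-- `G = Gl ⊕ Gr` (attachment composition). -/
def IsAttach (G Gl Gr : TSGraph α) : Prop :=
  Disjoint Gl.verts Gr.verts ∧
  G.verts = Gl.verts ∪ Gr.verts ∧
  (∀ u v, G.Adj u v ↔ Gl.Adj u v ∨ Gr.Adj u v ∨
    (u ∈ Gl.TS ∧ v ∈ Gr.TS) ∨ (u ∈ Gr.TS ∧ v ∈ Gl.TS)) ∧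
  G.TS = Gl.TS

/-- The twin-set graph `G` arises from a decomposition tree all of whose associated
twin-set graphs satisfy the property `P`. -/
inductive FromDecompTree (P : TSGraph α → Prop) : TSGraph α → Prop where
  | single (G : TSGraph α) (v : α) (hv : G.verts = {v}) (hts : G.TS = {v})
      (hadj : ∀ u w, ¬ G.Adj u w) (hP : P G) : FromDecompTree P G
  | ttwin (G Gl Gr : TSGraph α) (hl : FromDecompTree P Gl) (hr : FromDecompTree P Gr)
      (h : IsTrueTwin G Gl Gr) (hP : P G) : FromDecompTree P G
  | ftwin (G Gl Gr : TSGraph α) (hl : FromDecompTree P Gl) (hr : FromDecompTree P Gr)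
      (h : IsFalseTwin G Gl Gr) (hP : P G) : FromDecompTree P G
  | attach (G Gl Gr : TSGraph α) (hl : FromDecompTree P Gl) (hr : FromDecompTree P Gr)
      (h : IsAttach G Gl Gr) (hP : P G) : FromDecompTree P G

end TSGraph

namespace TSGraph

variable {α : Type*} [DecidableEq α]

theorem even_of_pm (G : TSGraph α) (S : Finset α) (f : α → α) (h : G.IsPM S f) :
    Even S.card := by
  have h0 : ∑ _v ∈ S, (1 : ZMod 2) = 0 := by
    refine Finset.sum_involution (fun v _ => f v) ?_ ?_ ?_ ?_
    · intro v hv; decide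
    · intro v hv _ he
      have := (h v hv).2.1
      rw [he] at this
      exact G.irrefl v this
    · intro v hv; exact (h v hv).1
    · intro v hv; exact (h v hv).2.2
  simp only [Finset.sum_const, nsmul_eq_mul, mul_one] at h0
  exact (ZMod.natCast_eq_zero_iff_even).1 h0

theorem Adm.parity {G : TSGraph α} {k : ℕ} {S : Finset α} (h : G.Adm k S) :
    S.card % 2 = k % 2 := by
  obtain ⟨_, _, X, hX, rfl, f, hf⟩ := h
  have h1 := even_of_pm G _ f hf
  have h2 : (S \ X).card + X.card = S.card :=
    Finset.card_sdiff_add_card_eq_card (hX.trans Finset.inter_subset_left)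
  obtain ⟨r, hr⟩ := h1
  omega

theorem Adm.le {G : TSGraph α} {k : ℕ} {S : Finset α} (h : G.Adm k S) :
    k ≤ G.TS.card := by
  obtain ⟨_, _, X, hX, rfl, f, hf⟩ := h
  exact Finset.card_le_card (hX.trans Finset.inter_subset_right)

theorem Adm.gamma_le {G : TSGraph α} {k : ℕ} {S : Finset α} (h : G.Adm k S) :
    G.gamma k ≤ S.card := Nat.sInf_le ⟨S, h, rfl⟩

theorem gamma_spec {G : TSGraph α} (hG : G.AllDkNonempty) {k : ℕ} (hk : k ≤ G.TS.card) :
    ∃ S, G.Adm k S ∧ S.card = G.gamma k := by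
  obtain ⟨S, hS, _⟩ := hG k hk
  exact Nat.sInf_mem (s := {n | ∃ S, G.Adm k S ∧ S.card = n}) ⟨_, S, hS, rfl⟩

theorem gamma_parity {G : TSGraph α} (hG : G.AllDkNonempty) {k : ℕ} (hk : k ≤ G.TS.card) :
    G.gamma k % 2 = k % 2 := by
  obtain ⟨S, hS, h⟩ := gamma_spec hG hk
  rw [← h]; exact hS.parity

theorem min_le (G : TSGraph α) {k : ℕ} (hk : k ≤ G.TS.card) : G.minVal ≤ G.gamma k :=
  Nat.sInf_le ⟨k, hk, rfl⟩

theorem min_spec (G : TSGraph α) : ∃ k ≤ G.TS.card, G.gamma k = G.minVal :=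
  Nat.sInf_mem (s := {n | ∃ k ≤ G.TS.card, G.gamma k = n}) ⟨_, 0, Nat.zero_le _, rfl⟩

theorem alpha_spec (G : TSGraph α) :
    G.alphaVal ≤ G.TS.card ∧ G.gamma G.alphaVal = G.minVal :=
  Nat.sInf_mem (s := {k | k ≤ G.TS.card ∧ G.gamma k = G.minVal}) (min_spec G)

theorem bdd (G : TSGraph α) : BddAbove {k | k ≤ G.TS.card ∧ G.gamma k = G.minVal} :=
  ⟨G.TS.card, fun _ h => h.1⟩

theorem beta_spec (G : TSGraph α) :
    G.betaVal ≤ G.TS.card ∧ G.gamma G.betaVal = G.minVal :=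
  Nat.sSup_mem (s := {k | k ≤ G.TS.card ∧ G.gamma k = G.minVal}) (min_spec G) (bdd G)

theorem alpha_le (G : TSGraph α) {k : ℕ} (hk : k ≤ G.TS.card) (h : G.gamma k = G.minVal) :
    G.alphaVal ≤ k := Nat.sInf_le ⟨hk, h⟩

theorem le_beta (G : TSGraph α) {k : ℕ} (hk : k ≤ G.TS.card) (h : G.gamma k = G.minVal) :
    k ≤ G.betaVal := le_csSup (bdd G) ⟨hk, h⟩

theorem eq2_mid {G : TSGraph α} (h2 : G.Eq2Holds) {k : ℕ} (h1 : G.alphaVal ≤ k)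
    (h3 : k ≤ G.betaVal) (hp : k % 2 = G.alphaVal % 2) : G.gamma k = G.minVal := by
  rcases h1.eq_or_lt with h | h
  · rw [← h]; exact (alpha_spec G).2
  rcases h3.eq_or_lt with h' | h'
  · rw [h']; exact (beta_spec G).2
  exact (h2 k (h3.trans (beta_spec G).1)).2.2.1 h h' (by rw [Nat.even_iff]; omega)

theorem attach_split {G Gl Gr : TSGraph α} (hc : IsAttach G Gl Gr) {k : ℕ} {S : Finset α}
    (h : G.Adm k S) :
    ∃ j Sl Sr, Gl.Adm (k + j) Sl ∧ Gr.Adm j Sr ∧ S.card = Sl.card + Sr.card := by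
  obtain ⟨hdis, hV, hA, hT⟩ := hc
  obtain ⟨hS, hdom, X, hX, hk, f, hf⟩ := h
  have hd : ∀ v, v ∈ Gl.verts → v ∈ Gr.verts → False :=
    fun v h1 h2 => Finset.disjoint_left.1 hdis h1 h2
  have hSm : ∀ v ∈ S, v ∈ Gl.verts ∨ v ∈ Gr.verts := by
    intro v hv; have := hS hv; rwa [hV, Finset.mem_union] at this
  have hXm : ∀ v ∈ X, v ∈ S ∧ v ∈ Gl.TS := by
    intro v hv; have := hX hv; rwa [hT, Finset.mem_inter] at this
  have hTl := Gl.TS_sub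
  have hTr := Gr.TS_sub
  have hAl : ∀ u v, G.Adj u v → u ∈ Gl.verts → v ∈ Gl.verts → Gl.Adj u v := by
    intro u v h hu hv
    rcases (hA u v).1 h with h | h | h | h
    · exact h
    · exact (hd _ hu (Gr.adj_mem _ _ h).1).elim
    · exact (hd _ hv (hTr h.2)).elim
    · exact (hd _ hu (hTr h.1)).elim
  have hAr : ∀ u v, G.Adj u v → u ∈ Gr.verts → v ∈ Gr.verts → Gr.Adj u v := by
    intro u v h hu hv
    rcases (hA u v).1 h with h | h | h | h
    · exact (hd _ (Gl.adj_mem _ _ h).1 hu).elim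
    · exact h
    · exact (hd _ (hTl h.1) hu).elim
    · exact (hd _ (hTl h.2) hv).elim
  have hAx : ∀ u v, G.Adj u v → u ∈ Gl.verts → v ∈ Gr.verts → u ∈ Gl.TS ∧ v ∈ Gr.TS := by
    intro u v h hu hv
    rcases (hA u v).1 h with h | h | h | h
    · exact (hd _ (Gl.adj_mem _ _ h).2 hv).elim
    · exact (hd _ hu (Gr.adj_mem _ _ h).1).elim
    · exact h
    · exact (hd _ hu (hTr h.1)).elim
  have hf' : ∀ v, v ∈ S → v ∉ X → f v ∈ S ∧ f v ∉ X ∧ G.Adj v (f v) ∧ f (f v) = v := by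
    intro v h1 h2
    have := hf v (Finset.mem_sdiff.2 ⟨h1, h2⟩)
    rw [Finset.mem_sdiff] at this
    exact ⟨this.1.1, this.1.2, this.2⟩
  let Cl := (S \ X).filter (fun v => v ∈ Gl.verts ∧ f v ∈ Gr.verts)
  let Cr := (S \ X).filter (fun v => v ∈ Gr.verts ∧ f v ∈ Gl.verts)
  have mCl : ∀ v, v ∈ Cl ↔ (v ∈ S ∧ v ∉ X) ∧ v ∈ Gl.verts ∧ f v ∈ Gr.verts := by
    intro v; simp [Cl]
  have mCr : ∀ v, v ∈ Cr ↔ (v ∈ S ∧ v ∉ X) ∧ v ∈ Gr.verts ∧ f v ∈ Gl.verts := by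
    intro v; simp [Cr]
  have hcard : Cl.card = Cr.card := by
    refine Finset.card_nbij' f f ?_ ?_ ?_ ?_
    · intro v hv
      have hv := (mCl v).1 hv
      have := hf' v hv.1.1 hv.1.2
      refine (mCr _).2 ⟨⟨this.1, this.2.1⟩, hv.2.2, ?_⟩
      rw [this.2.2.2]; exact hv.2.1
    · intro v hv
      have hv := (mCr v).1 hv
      have := hf' v hv.1.1 hv.1.2
      refine (mCl _).2 ⟨⟨this.1, this.2.1⟩, hv.2.2, ?_⟩
      rw [this.2.2.2]; exact hv.2.1
    · intro v hv
      have hv := (mCl v).1 hv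
      exact (hf' v hv.1.1 hv.1.2).2.2.2
    · intro v hv
      have hv := (mCr v).1 hv
      exact (hf' v hv.1.1 hv.1.2).2.2.2
  refine ⟨Cl.card, S ∩ Gl.verts, S ∩ Gr.verts, ?_, ?_, ?_⟩
  · refine ⟨Finset.inter_subset_right, ?_, X ∪ Cl, ?_, ?_, f, ?_⟩
    · intro v hv hvt
      rcases hdom v (by rw [hV]; exact Finset.mem_union_left _ hv) (by rwa [hT]) with h | ⟨u, hu, hadj⟩
      · exact Or.inl (Finset.mem_inter.2 ⟨h, hv⟩)
      · right
        rcases hSm u hu with h | h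
        · exact ⟨u, Finset.mem_inter.2 ⟨hu, h⟩, hAl _ _ hadj h hv⟩
        · exact (hvt (hAx _ _ (G.symm _ _ hadj) hv h).1).elim
    · intro v hv
      rcases Finset.mem_union.1 hv with h | h
      · have := hXm v h
        simp [this.1, this.2, hTl this.2]
      · have h := (mCl v).1 h
        have := hf' v h.1.1 h.1.2
        have := (hAx _ _ this.2.2.1 h.2.1 h.2.2).1
        simp [h.1.1, h.2.1, this]
    · rw [Finset.card_union_of_disjoint, hk]
      rw [Finset.disjoint_left]
      intro v h1 h2
      exact ((mCl v).1 h2).1.2 h1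
    · intro v hv
      simp only [Finset.mem_sdiff, Finset.mem_inter, Finset.mem_union, mCl, not_or, not_and] at hv ⊢
      obtain ⟨⟨h1, h2⟩, h3, h4⟩ := hv
      obtain ⟨g1, g2, g3, g4⟩ := hf' v h1 h3
      have g5 : f v ∈ Gl.verts := (hSm _ g1).resolve_right (h4 ⟨h1, h3⟩ h2)
      refine ⟨⟨⟨g1, g5⟩, g2, ?_⟩, hAl _ _ g3 h2 g5, g4⟩
      intro _ _ h6
      rw [g4] at h6
      exact hd _ h2 h6
  · refine ⟨Finset.inter_subset_right, ?_, Cr, ?_, hcard.symm, f, ?_⟩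
    · intro v hv hvt
      rcases hdom v (by rw [hV]; exact Finset.mem_union_right _ hv)
        (by rw [hT]; exact fun h => hd _ (hTl h) hv) with h | ⟨u, hu, hadj⟩
      · exact Or.inl (Finset.mem_inter.2 ⟨h, hv⟩)
      · right
        rcases hSm u hu with h | h
        · exact (hvt (hAx _ _ hadj h hv).2).elim
        · exact ⟨u, Finset.mem_inter.2 ⟨hu, h⟩, hAr _ _ hadj h hv⟩
    · intro v h
      have h := (mCr v).1 h
      have := hf' v h.1.1 h.1.2
      have := (hAx _ _ (G.symm _ _ this.2.2.1) h.2.2 h.2.1).2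
      simp [h.1.1, h.2.1, this]
    · intro v hv
      simp only [Finset.mem_sdiff, Finset.mem_inter, mCr, not_and] at hv ⊢
      obtain ⟨⟨h1, h2⟩, h4⟩ := hv
      have h3 : v ∉ X := fun h => hd _ (hTl (hXm v h).2) h2
      obtain ⟨g1, g2, g3, g4⟩ := hf' v h1 h3
      have g5 : f v ∈ Gr.verts := (hSm _ g1).resolve_left (h4 ⟨h1, h3⟩ h2)
      refine ⟨⟨⟨g1, g5⟩, ?_⟩, hAr _ _ g3 h2 g5, g4⟩
      intro _ _ h6
      rw [g4] at h6
      exact hd _ h6 h2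
  · rw [← Finset.card_union_of_disjoint, ← Finset.inter_union_distrib_left, ← hV,
      Finset.inter_eq_left.2 hS]
    exact hdis.mono Finset.inter_subset_right Finset.inter_subset_right

theorem attach_glue {G Gl Gr : TSGraph α} (hc : IsAttach G Gl Gr) {k j : ℕ} {Sl Sr : Finset α}
    (h1 : Gl.Adm (k + j) Sl) (h2 : Gr.Adm j Sr) (hpos : 0 < k + j) :
    G.Adm k (Sl ∪ Sr) ∧ (Sl ∪ Sr).card = Sl.card + Sr.card := by
  obtain ⟨hdis, hV, hA, hT⟩ := hc
  obtain ⟨hSl, hdl, Xl, hXl, hkl, fl, hfl⟩ := h1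
  obtain ⟨hSr, hdr, Xr, hXr, hkr, fr, hfr⟩ := h2
  have hd : ∀ v, v ∈ Gl.verts → v ∈ Gr.verts → False :=
    fun v h1 h2 => Finset.disjoint_left.1 hdis h1 h2
  have hTl := Gl.TS_sub
  have hTr := Gr.TS_sub
  obtain ⟨Y, hY, hYc⟩ := Finset.exists_subset_card_eq (s := Xl) (n := j) (by omega)
  let e := Finset.equivOfCardEq (hYc.trans hkr.symm)
  let g : α → α := fun v => if h : v ∈ Y then e ⟨v, h⟩ else v
  let g' : α → α := fun v => if h : v ∈ Xr then e.symm ⟨v, h⟩ else v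
  have hg : ∀ v ∈ Y, g v ∈ Xr ∧ g' (g v) = v := by
    intro v hv
    simp [g, g', hv]
  have hg' : ∀ v ∈ Xr, g' v ∈ Y ∧ g (g' v) = v := by
    intro v hv
    simp [g, g', hv]
  clear_value g g'
  have hXl' : ∀ v ∈ Xl, v ∈ Sl ∧ v ∈ Gl.TS := fun v hv => Finset.mem_inter.1 (hXl hv)
  have hXr' : ∀ v ∈ Xr, v ∈ Sr ∧ v ∈ Gr.TS := fun v hv => Finset.mem_inter.1 (hXr hv)
  refine ⟨⟨?_, ?_, Xl \ Y, ?_, ?_,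
    fun v => if v ∈ Y then g v else if v ∈ Xr then g' v else if v ∈ Gl.verts then fl v else fr v,
    ?_⟩, ?_⟩
  · rw [hV]; exact Finset.union_subset_union hSl hSr
  · intro v hv hvt
    rw [hT] at hvt
    rw [hV, Finset.mem_union] at hv
    rcases hv with hv | hv
    · rcases hdl v hv hvt with h | ⟨u, hu, h⟩
      · exact Or.inl (Finset.mem_union_left _ h)
      · exact Or.inr ⟨u, Finset.mem_union_left _ hu, (hA _ _).2 (Or.inl h)⟩
    · by_cases hvr : v ∈ Gr.TS
      · right
        obtain ⟨u, hu⟩ : Xl.Nonempty := Finset.card_pos.1 (by omega)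
        exact ⟨u, Finset.mem_union_left _ (hXl' u hu).1,
          (hA _ _).2 (Or.inr (Or.inr (Or.inl ⟨(hXl' u hu).2, hvr⟩)))⟩
      · rcases hdr v hv hvr with h | ⟨u, hu, h⟩
        · exact Or.inl (Finset.mem_union_right _ h)
        · exact Or.inr ⟨u, Finset.mem_union_right _ hu, (hA _ _).2 (Or.inr (Or.inl h))⟩
  · intro v hv
    have := hXl' v (Finset.mem_sdiff.1 hv).1
    simp [hT, this.1, this.2]
  · rw [Finset.card_sdiff_of_subset hY]; omega
  · have hYl : ∀ v ∈ Y, v ∈ Gl.verts := fun v hv => hSl (hXl' v (hY hv)).1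
    have hXrv : ∀ v ∈ Xr, v ∈ Gr.verts := fun v hv => hSr (hXr' v hv).1
    have hYX : ∀ v ∈ Xr, v ∉ Y := fun v hv h => hd v (hYl v h) (hXrv v hv)
    intro v hv
    simp only [Finset.mem_sdiff, Finset.mem_union, not_and, not_not] at hv ⊢
    by_cases c1 : v ∈ Y
    · obtain ⟨i1, i2⟩ := hg v c1
      have i3 := hYX _ i1
      simp only [c1, if_true, i3, i1, i2, if_false, and_true]
      refine ⟨⟨Or.inr (hXr' _ i1).1, fun h => (hd _ (hSl (hXl' _ h).1) (hXrv _ i1)).elim⟩, ?_⟩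
      exact (hA _ _).2 (Or.inr (Or.inr (Or.inl ⟨(hXl' v (hY c1)).2, (hXr' _ i1).2⟩)))
    by_cases c2 : v ∈ Xr
    · obtain ⟨i1, i2⟩ := hg' v c2
      simp only [c1, c2, if_true, i1, i2, if_false, and_true]
      refine ⟨⟨Or.inl (hXl' _ (hY i1)).1, fun _ => trivial⟩, ?_⟩
      exact (hA _ _).2 (Or.inr (Or.inr (Or.inr ⟨(hXr' v c2).2, (hXl' _ (hY i1)).2⟩)))
    have c3 : v ∉ Xl := fun h => c1 (hv.2 h)
    rcases hv.1 with c4 | c4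
    · obtain ⟨i1, i2, i3⟩ := hfl v (Finset.mem_sdiff.2 ⟨c4, c3⟩)
      rw [Finset.mem_sdiff] at i1
      have j1 : fl v ∉ Y := fun h => i1.2 (hY h)
      have j2 : fl v ∉ Xr := fun h => hd _ (hSl i1.1) (hXrv _ h)
      simp only [c1, c2, hSl c4, if_true, if_false, j1, j2, hSl i1.1, i3, and_true]
      exact ⟨⟨Or.inl i1.1, fun h => i1.2 h⟩, (hA _ _).2 (Or.inl i2)⟩
    · obtain ⟨i1, i2, i3⟩ := hfr v (Finset.mem_sdiff.2 ⟨c4, c2⟩)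
      rw [Finset.mem_sdiff] at i1
      have j0 : v ∉ Gl.verts := fun h => hd _ h (hSr c4)
      have j3 : fr v ∉ Gl.verts := fun h => hd _ h (hSr i1.1)
      have j1 : fr v ∉ Y := fun h => j3 (hYl _ h)
      simp only [c1, c2, j0, if_false, j1, i1.2, j3, i3, and_true]
      exact ⟨⟨Or.inr i1.1, fun h => j3 (hSl (hXl' _ h).1)⟩, (hA _ _).2 (Or.inr (Or.inl i2))⟩
  · exact Finset.card_union_of_disjoint (hdis.mono hSl hSr)

end TSGraph

set_option maxHeartbeats 4000000

open TSGraph in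
/-- attachment, case `C_1`: with all `D_k` families nonempty and
Equation (2) holding for `Gl` and `Gr`, if `α(Gr) ≤ β(Gl)` and neither
`(α(Gl) = 0 ∧ β(Gr) = 0)` nor `(α(Gr) = 0 ∧ β(Gl) = 0)`, then
`min(G) = min(Gl) + min(Gr)`, `β(G) = β(Gl) − α(Gr)`, and `α(G)` is
`α(Gl) − β(Gr)` if `α(Gl) > β(Gr)` and `|α(Gl) − α(Gr)| mod 2` otherwise. -/
theorem stmt17 {α : Type*} [DecidableEq α] (G Gl Gr : TSGraph α)
    (hcomp : IsAttach G Gl Gr)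
    (hG : G.AllDkNonempty) (hGl : Gl.AllDkNonempty) (hGr : Gr.AllDkNonempty)
    (hl : Gl.Eq2Holds) (hr : Gr.Eq2Holds)
    (hD1 : Gr.alphaVal ≤ Gl.betaVal)
    (hD2a : ¬ (Gl.alphaVal = 0 ∧ Gr.betaVal = 0))
    (hD2b : ¬ (Gr.alphaVal = 0 ∧ Gl.betaVal = 0)) :
    G.minVal = Gl.minVal + Gr.minVal ∧
    G.betaVal = Gl.betaVal - Gr.alphaVal ∧
    (Gl.alphaVal > Gr.betaVal → G.alphaVal = Gl.alphaVal - Gr.betaVal) ∧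
    (¬ Gl.alphaVal > Gr.betaVal →
      G.alphaVal = ((Gl.alphaVal : ℤ) - (Gr.alphaVal : ℤ)).natAbs % 2) := by
  have lowA : ∀ k ≤ G.TS.card, ∃ j, k + j ≤ Gl.TS.card ∧ j ≤ Gr.TS.card ∧
      Gl.gamma (k + j) + Gr.gamma j ≤ G.gamma k := by
    intro k hk
    obtain ⟨S, hS, hSc⟩ := gamma_spec hG hk
    obtain ⟨j, Sl, Sr, h1, h2, h3⟩ := attach_split hcomp hS
    have := h1.gamma_le
    have := h2.gamma_le
    exact ⟨j, h1.le, h2.le, by omega⟩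
  have upA : ∀ k j, k + j ≤ Gl.TS.card → j ≤ Gr.TS.card → 0 < k + j →
      G.gamma k ≤ Gl.gamma (k + j) + Gr.gamma j := by
    intro k j h1 h2 hpos
    obtain ⟨Sl, hSl, hl1⟩ := gamma_spec hGl h1
    obtain ⟨Sr, hSr, hr1⟩ := gamma_spec hGr h2
    obtain ⟨h3, h4⟩ := attach_glue hcomp hSl hSr hpos
    have := h3.gamma_le
    omega
  have hTS : G.TS = Gl.TS := hcomp.2.2.2
  obtain ⟨la1, la2⟩ := alpha_spec Gl
  obtain ⟨lb1, lb2⟩ := beta_spec Gl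
  obtain ⟨ra1, ra2⟩ := alpha_spec Gr
  obtain ⟨rb1, rb2⟩ := beta_spec Gr
  have lpa := gamma_parity hGl la1
  have lpb := gamma_parity hGl lb1
  have rpa := gamma_parity hGr ra1
  have rpb := gamma_parity hGr rb1
  have lab := le_beta Gl la1 la2
  have rab := le_beta Gr ra1 ra2
  have lowM : ∀ k ≤ G.TS.card, Gl.minVal + Gr.minVal ≤ G.gamma k := by
    intro k hk
    obtain ⟨j, h1, h2, h3⟩ := lowA k hk
    have := min_le Gl h1
    have := min_le Gr h2
    omega
  have hit : ∀ k j, Gl.alphaVal ≤ k + j → k + j ≤ Gl.betaVal →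
      (k + j) % 2 = Gl.alphaVal % 2 → Gr.alphaVal ≤ j → j ≤ Gr.betaVal →
      j % 2 = Gr.alphaVal % 2 → 0 < k + j →
      k ≤ G.TS.card ∧ G.gamma k = Gl.minVal + Gr.minVal := by
    intro k j h1 h2 h3 h4 h5 h6 h7
    have e1 := eq2_mid hl h1 h2 h3
    have e2 := eq2_mid hr h4 h5 h6
    have e3 := upA k j (by omega) (by omega) h7
    have hk : k ≤ G.TS.card := by rw [hTS]; omega
    have e4 := lowM k hk
    exact ⟨hk, by omega⟩
  have hb := hit (Gl.betaVal - Gr.alphaVal) Gr.alphaVal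
    (by omega) (by omega) (by omega) (by omega) (by omega) (by omega) (by omega)
  have hmin : G.minVal = Gl.minVal + Gr.minVal := by
    have h1 := min_le G hb.1
    obtain ⟨k, hk, h2⟩ := min_spec G
    have := lowM k hk
    omega
  have conv : ∀ k ≤ G.TS.card, G.gamma k = G.minVal → ∃ j,
      Gl.alphaVal ≤ k + j ∧ k + j ≤ Gl.betaVal ∧ Gr.alphaVal ≤ j ∧ j ≤ Gr.betaVal ∧
      (k + j) % 2 = Gl.alphaVal % 2 ∧ j % 2 = Gr.alphaVal % 2 := by
    intro k hk h
    obtain ⟨j, h1, h2, h3⟩ := lowA k hk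
    have h4 := min_le Gl h1
    have h5 := min_le Gr h2
    have h6 : Gl.gamma (k + j) = Gl.minVal := by omega
    have h7 : Gr.gamma j = Gr.minVal := by omega
    have p1 := gamma_parity hGl h1
    have p2 := gamma_parity hGr h2
    exact ⟨j, alpha_le Gl h1 h6, le_beta Gl h1 h6, alpha_le Gr h2 h7, le_beta Gr h2 h7,
      by omega, by omega⟩
  have alphaEq : ∀ k j, Gl.alphaVal ≤ k + j → k + j ≤ Gl.betaVal →
      (k + j) % 2 = Gl.alphaVal % 2 → Gr.alphaVal ≤ j → j ≤ Gr.betaVal →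
      j % 2 = Gr.alphaVal % 2 → 0 < k + j → G.alphaVal ≤ k := by
    intro k j h1 h2 h3 h4 h5 h6 h7
    obtain ⟨hk, h⟩ := hit k j h1 h2 h3 h4 h5 h6 h7
    exact alpha_le G hk (h.trans hmin.symm)
  obtain ⟨ga1, ga2⟩ := alpha_spec G
  obtain ⟨ja, ca⟩ := conv _ ga1 ga2
  refine ⟨hmin, ?_, ?_, ?_⟩
  · obtain ⟨gb1, gb2⟩ := beta_spec G
    have h1 := le_beta G hb.1 (hb.2.trans hmin.symm)
    obtain ⟨j, hj⟩ := conv _ gb1 gb2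
    omega
  · intro hgt
    have := alphaEq (Gl.alphaVal - Gr.betaVal) Gr.betaVal
      (by omega) (by omega) (by omega) (by omega) (by omega) (by omega) (by omega)
    omega
  · intro hgt
    by_cases hp : Gl.alphaVal % 2 = Gr.alphaVal % 2
    · have : G.alphaVal ≤ 0 := by
        by_cases hz : Gl.alphaVal = 0 ∧ Gr.alphaVal = 0
        · exact alphaEq 0 2 (by omega) (by omega) (by omega) (by omega) (by omega) (by omega)
            (by omega)
        · exact alphaEq 0 (max Gl.alphaVal Gr.alphaVal) (by omega) (by omega) (by omega)
            (by omega) (by omega) (by omega) (by omega)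
      omega
    · have : G.alphaVal ≤ 1 := by
        by_cases hz : Gr.alphaVal < Gl.alphaVal
        · exact alphaEq 1 (Gl.alphaVal - 1) (by omega) (by omega) (by omega) (by omega)
            (by omega) (by omega) (by omega)
        · exact alphaEq 1 Gr.alphaVal (by omega) (by omega) (by omega)
            (by omega) (by omega) (by omega) (by omega)
      omega
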